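/- Let (G,·) be a set with a binary operation and a distinguished element 0, and let (H,∘) be the A-holomorph of (G,·). Then (H,∘,(id,0)) is a p-semisimple BCI-algebra if and only if (G,·,0) is a p-semisimple BCI-algebra and ((δ(x)·δ(y))·(x·γ(z)))·(z·y) = 0 for all x,y,z ∈ G and all δ,γ ∈ A. -/

import Mathlib

def IsBCI {G : Type*} (op : G → G → G) (e : G) : Prop :=
  (∀ x y z, op (op (op x y) (op x z)) (op z y) = e) ∧
  (∀ x, op x e = x) ∧
  (∀ x y, op x y = e → op y x = e → x = y)

def IsPSemisimple {G : Type*} (op : G → G → G) (e : G) : Prop :=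
  ∀ x, op e (op e x) = x

/-- The operation of the `A`-holomorph of `(G, op)`:
`(α,x)∘(β,y) = (αβ, β(x)·y)`. -/
def holOp {G : Type*} (op : G → G → G) (A : Subgroup (Equiv.Perm G)) :
    A × G → A × G → A × G :=
  fun p q => (p.1 * q.1, op ((q.1 : Equiv.Perm G) p.2) q.2)

theorem IsBCI.op_self {G : Type*} {op : G → G → G} {e : G} (h : IsBCI op e) (x : G) :
    op x x = e := by
  simpa only [h.2.1] using h.1 x e e

/-- An endomorphism of the operation of a BCI-algebra fixes the zero element. -/
theorem IsBCI.map_zero {G : Type*} {op : G → G → G} {e : G} (h : IsBCI op e) {φ : G → G}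
    (hφ : ∀ x y, φ (op x y) = op (φ x) (φ y)) : φ e = e := by
  rw [← h.op_self e, hφ, h.op_self, h.op_self]

/-- The compatibility condition forces every automorphism in `A` to be trivial. -/
theorem IsBCI.eq_one_of_compat {G : Type*} {op : G → G → G} {e : G} (h : IsBCI op e)
    {A : Subgroup (Equiv.Perm G)}
    (hAut : ∀ φ : Equiv.Perm G, φ ∈ A → ∀ x y : G, φ (op x y) = op (φ x) (φ y))
    (hc : ∀ δ : Equiv.Perm G, δ ∈ A → ∀ γ : Equiv.Perm G, γ ∈ A → ∀ x y z : G,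
      op (op (op (δ x) (δ y)) (op x (γ z))) (op z y) = e)
    {δ : Equiv.Perm G} (hδ : δ ∈ A) : δ = 1 := by
  have key : ∀ φ ∈ A, ∀ x, op (φ x) x = e := fun φ hφ x => by
    simpa only [h.map_zero (hAut φ hφ), Equiv.Perm.one_apply, h.2.1] using
      hc φ hφ 1 A.one_mem x e e
  ext x
  refine h.2.2 _ _ (key δ hδ x) ?_
  simpa using key δ⁻¹ (A.inv_mem hδ) (δ x)

theorem holomorph_pSemisimple_BCI_iff {G : Type*} (op : G → G → G) (e : G)
    (A : Subgroup (Equiv.Perm G))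
    (hAut : ∀ φ : Equiv.Perm G, φ ∈ A → ∀ x y : G, φ (op x y) = op (φ x) (φ y))
    (hBool : ∀ φ : Equiv.Perm G, φ ∈ A → φ * φ = 1) :
    (IsBCI (holOp op A) ((1 : A), e) ∧ IsPSemisimple (holOp op A) ((1 : A), e)) ↔
      ((IsBCI op e ∧ IsPSemisimple op e) ∧
        (∀ δ : Equiv.Perm G, δ ∈ A → ∀ γ : Equiv.Perm G, γ ∈ A → ∀ x y z : G, op (op (op (δ x) (δ y)) (op x (γ z))) (op z y) = e)) := by
  constructor
  · rintro ⟨⟨h1, h2, h3⟩, h4⟩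
    have right_zero : ∀ x, op x e = x := fun x => by
      simpa [holOp] using congrArg Prod.snd (h2 (1, x))
    have map_zero : ∀ φ ∈ A, φ e = e := fun φ hφ => by
      have := congrArg Prod.snd (h4 (⟨φ, hφ⟩, e))
      simp only [holOp, right_zero, one_mul] at this
      rwa [← hAut φ hφ, right_zero] at this
    refine ⟨⟨⟨fun x y z => ?_, right_zero, fun x y hxy hyx => ?_⟩, fun x => ?_⟩,
      fun δ hδ γ hγ x y z => ?_⟩
    · simpa [holOp] using congrArg Prod.snd (h1 (1, x) (1, y) (1, z))
    · exact congrArg Prod.snd (h3 (1, x) (1, y) (by simp [holOp, hxy]) (by simp [holOp, hyx]))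
    · simpa [holOp] using congrArg Prod.snd (h4 (1, x))
    · have hγγ : ∀ w, γ (γ w) = w := fun w => Equiv.congr_fun (hBool γ hγ) w
      have hδδ : ∀ w, δ (δ w) = w := fun w => Equiv.congr_fun (hBool δ hδ) w
      have comm : ∀ w, γ (δ (γ w)) = δ w := fun w => by
        have := Equiv.congr_fun (hBool (γ * δ) (A.mul_mem hγ hδ)) (δ w)
        simpa [hδδ] using this
      simpa [holOp, hAut γ hγ, hAut δ hδ, hγγ, hδδ, comm] using
        congrArg Prod.snd (h1 (⟨δ, hδ⟩, x) (1, y) (⟨γ, hγ⟩, z))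
  · rintro ⟨⟨h, hp⟩, hc⟩
    have hone : ∀ a : A, a = 1 := fun a => Subtype.ext (h.eq_one_of_compat hAut hc a.2)
    have hop : ∀ p q : A × G, holOp op A p q = (1, op p.2 q.2) := fun p q => by
      simp [holOp, hone p.1, hone q.1]
    refine ⟨⟨fun p q r => ?_, fun p => ?_, fun p q hpq hqp => ?_⟩, fun p => ?_⟩
    · simp only [hop, h.1]
    · rw [hop, h.2.1, ← hone p.1]
    · rw [hop] at hpq hqp
      exact Prod.ext ((hone _).trans (hone _).symm)
        (h.2.2 _ _ (congrArg Prod.snd hpq) (congrArg Prod.snd hqp))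
    · rw [hop, hop, hp, ← hone p.1]
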